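/- Let q be a positive integer and let N = m̄+3k for positive integers m̄, k. Let A_i, A_j be n×N integer matrices and rk an N×N integer matrix with A_i·rk ≡ A_j (mod q) entrywise, and suppose the last k rows of rk equal the block row [0 | 0 | 0 | I_k] (zeros in the first m̄+2k columns, identity in the last k columns). Then for all integer vectors s ∈ ℤⁿ, e ∈ ℤ^N, c ∈ ℤ^k and b ∈ ℤ^N with bᵀ ≡ 2·sᵀA_i + eᵀ + (0, 0, 0, cᵀ) (mod 2q) entrywise (where (0,0,0,cᵀ) has zero blocks of lengths m̄, k, k followed by cᵀ), it holds that bᵀ·rk ≡ 2·sᵀA_j + eᵀ·rk + (0, 0, 0, cᵀ) (mod 2q) entrywise. -/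

import Mathlib

open Matrix

/-- multiplying a ciphertext under identity `i` by the re-encryption key `rk`
(with `A_i·rk ≡ A_j (mod q)` and last block row `[0 0 0 I]`) yields a well-formed
ciphertext under identity `j` with noise `eᵀ·rk` and unchanged message encoding. -/
theorem stmt_5 (q n mbar k : ℕ) (hq : 0 < q)
    (Ai Aj : Matrix (Fin n) (((Fin mbar ⊕ Fin k) ⊕ Fin k) ⊕ Fin k) ℤ)
    (rk : Matrix (((Fin mbar ⊕ Fin k) ⊕ Fin k) ⊕ Fin k) (((Fin mbar ⊕ Fin k) ⊕ Fin k) ⊕ Fin k) ℤ)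
    (hmod : ∀ i j, (q : ℤ) ∣ ((Ai * rk) i j - Aj i j))
    (hlast : ∀ (r : Fin k) (col : ((Fin mbar ⊕ Fin k) ⊕ Fin k) ⊕ Fin k),
      rk (Sum.inr r) col = if col = Sum.inr r then 1 else 0) :
    ∀ (s : Fin n → ℤ) (e b : ((Fin mbar ⊕ Fin k) ⊕ Fin k) ⊕ Fin k → ℤ) (c : Fin k → ℤ),
      (∀ j, (2 * q : ℤ) ∣
        (b j - (2 * Matrix.vecMul s Ai j + e j + Sum.elim (fun _ => (0 : ℤ)) c j))) →
      ∀ j, (2 * q : ℤ) ∣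
        (Matrix.vecMul b rk j - (2 * Matrix.vecMul s Aj j + Matrix.vecMul e rk j
          + Sum.elim (fun _ => (0 : ℤ)) c j)) := by
  intro s e b c hb j
  choose d hd using hb
  choose D hD using hmod
  have hbe : b = (2 : ℤ) • Matrix.vecMul s Ai + e + Sum.elim (fun _ => (0 : ℤ)) c
      + (2 * q : ℤ) • d := by
    funext x
    have := hd x
    simp only [Pi.add_apply, Pi.smul_apply, smul_eq_mul]
    linarith
  have hA : Ai * rk = Aj + (q : ℤ) • Matrix.of D := by
    ext x y
    have := hD x y
    simp only [Matrix.add_apply, Matrix.smul_apply, Matrix.of_apply, smul_eq_mul]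
    linarith
  have hc : Matrix.vecMul (Sum.elim (fun _ => (0 : ℤ)) c) rk
      = Sum.elim (fun _ => (0 : ℤ)) c := by
    funext x
    rcases x with x | x <;>
      simp [Matrix.vecMul, dotProduct, Fintype.sum_sum_type, hlast]
  refine ⟨Matrix.vecMul s (Matrix.of D) j + Matrix.vecMul d rk j, ?_⟩
  rw [hbe]
  simp only [Matrix.add_vecMul, Matrix.smul_vecMul, Matrix.vecMul_vecMul, hA, hc,
    Matrix.vecMul_add, Matrix.vecMul_smul, Pi.add_apply, Pi.smul_apply, smul_eq_mul]
  ring
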